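/- arXiv:0902.0115 — 3 statements merged into one kernel-verified Lean document; each statement's English description precedes it below -/
import Mathlib

section
/- For every transient Markov chain on a countable state space, started at any fixed state, the expected number of cut-times of the trajectory is infinite; equivalently, the sum over t ∈ ℕ of the probability that t is a cut-time diverges. -/
open MeasureTheory

/-- `μ` is the law on trajectory space `ℕ → S` of the Markov chain with (countable-state)
transition probabilities `p` started at `x₀`: it is a probability measure, it starts at
`x₀`, and it satisfies the Markov property on cylinder events. -/
def IsMarkovChain {S : Type*} [MeasurableSpace S] (p : S → S → ENNReal) (x₀ : S)
    (μ : Measure (ℕ → S)) : Prop :=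
  IsProbabilityMeasure μ ∧
  μ {ω | ω 0 = x₀} = 1 ∧
  ∀ (n : ℕ) (v : ℕ → S),
    μ {ω | ∀ i ≤ n + 1, ω i = v i} = μ {ω | ∀ i ≤ n, ω i = v i} * p (v n) (v (n + 1))

namespace CutTimes

variable {S : Type*}

/-- Probability of hitting `s` from `u` within `n` steps. -/
noncomputable def hitN (p : S → S → ENNReal) (s : S) : ℕ → S → ENNReal
  | 0, u => by classical exact if u = s then 1 else 0
  | n + 1, u => by classical exact if u = s then 1 else ∑' v, p u v * hitN p s n v

/-- Probability of hitting `s` from `u`. -/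
noncomputable def hit (p : S → S → ENNReal) (s u : S) : ENNReal := ⨆ n, hitN p s n u

/-- running minimum -/
noncomputable def runMin (h : S → ENNReal) (ω : ℕ → S) : ℕ → ENNReal
  | 0 => h (ω 0)
  | n + 1 => min (runMin h ω n) (h (ω (n + 1)))

/-- cylinder -/
def cyl (n : ℕ) (v : ℕ → S) : Set (ℕ → S) := {ω | ∀ i ≤ n, ω i = v i}

lemma hitN_self (p : S → S → ENNReal) (s : S) (n : ℕ) : hitN p s n s = 1 := by
  cases n <;> simp [hitN]

lemma hitN_le_one (p : S → S → ENNReal) (hp : ∀ s : S, ∑' t : S, p s t = 1) (s : S) (n : ℕ) :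
    ∀ u, hitN p s n u ≤ 1 := by
  induction n with
  | zero => intro u; simp only [hitN]; split_ifs <;> simp
  | succ n ih =>
    intro u
    simp only [hitN]
    split_ifs
    · exact le_rfl
    · calc ∑' v, p u v * hitN p s n v ≤ ∑' v, p u v * 1 :=
            ENNReal.tsum_le_tsum fun v => mul_le_mul_right (ih v) _
        _ = 1 := by simp [hp]

lemma hitN_mono_succ (p : S → S → ENNReal) (s : S) (n : ℕ) :
    ∀ u, hitN p s n u ≤ hitN p s (n + 1) u := by
  induction n with
  | zero => intro u; simp only [hitN]; split_ifs <;> simp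
  | succ n ih =>
    intro u
    rw [hitN, hitN]
    split_ifs
    · exact le_rfl
    · exact ENNReal.tsum_le_tsum fun v => mul_le_mul_right (ih v) _

lemma hitN_mono (p : S → S → ENNReal) (s u : S) : Monotone fun n => hitN p s n u :=
  monotone_nat_of_le_succ fun n => hitN_mono_succ p s n u

lemma hit_le_one (p : S → S → ENNReal) (hp : ∀ s : S, ∑' t : S, p s t = 1) (s u : S) :
    hit p s u ≤ 1 := iSup_le fun n => hitN_le_one p hp s n u

lemma hit_self (p : S → S → ENNReal) (s : S) : hit p s s = 1 := by
  simp [hit, hitN_self]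

lemma tsum_iSup_mono (F : ℕ → S → ENNReal) (hF : ∀ v, Monotone fun n => F n v) :
    ∑' v, ⨆ n, F n v = ⨆ n, ∑' v, F n v := by
  let _ : MeasurableSpace S := ⊤
  rw [← lintegral_count, lintegral_iSup]
  · simp [lintegral_count]
  · intro n; exact measurable_from_top
  · intro a b hab v; exact hF v hab

lemma hit_super (p : S → S → ENNReal) (hp : ∀ s : S, ∑' t : S, p s t = 1) (s u : S) :
    ∑' v, p u v * hit p s v ≤ hit p s u := by
  by_cases hus : u = s
  · subst hus
    rw [hit_self]
    calc ∑' v, p u v * hit p u v ≤ ∑' v, p u v * 1 :=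
            ENNReal.tsum_le_tsum fun v => mul_le_mul_right (hit_le_one p hp u v) _
        _ = 1 := by simp [hp]
  · simp only [hit, ENNReal.mul_iSup]
    rw [tsum_iSup_mono]
    · refine iSup_le fun n => le_trans ?_ (le_iSup _ (n + 1))
      simp [hitN, hus]
    · intro v a b hab
      exact mul_le_mul_right (hitN_mono p s v hab) _

/-- deterministic lemma -/
lemma sum_ratio_top (a : ℕ → ENNReal) (ha0 : ∀ n, a n ≠ 0) (hat : ∀ n, a n ≠ ⊤)
    (hanti : Antitone a) (hinf : ⨅ n, a n = 0) : ∑' n, (1 - a (n + 1) / a n) = ⊤ := by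
  by_contra hne
  have htail := ENNReal.tendsto_tsum_compl_atTop_zero hne
  have h2 := ENNReal.tendsto_sum_nat_add (fun n => 1 - a (n + 1) / a n) hne
  have hev := (ENNReal.tendsto_atTop_zero.1 h2) (2⁻¹) (by simp)
  obtain ⟨N, hN⟩ := hev
  have hN := hN N le_rfl
  have key : ∀ n, a N ≤ a (N + n) + a N * ∑ k ∈ Finset.range n, (1 - a (k + N + 1) / a (k + N)) := by
    intro n
    induction n with
    | zero => simp
    | succ n ih =>
      rw [Finset.sum_range_succ, mul_add]
      refine ih.trans ?_
      have h3 : a (N + n) ≤ a (N + (n + 1)) + a N * (1 - a (n + N + 1) / a (n + N)) := by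
        have e1 : a (n + N) * (a (n + N + 1) / a (n + N)) = a (n + N + 1) :=
          ENNReal.mul_div_cancel (ha0 _) (hat _)
        calc a (N + n) = a (n + N) * 1 := by rw [mul_one, add_comm]
          _ ≤ a (n + N) * (a (n + N + 1) / a (n + N) + (1 - a (n + N + 1) / a (n + N))) := by
              gcongr; exact le_add_tsub
          _ = a (n + N + 1) + a (n + N) * (1 - a (n + N + 1) / a (n + N)) := by
              rw [mul_add, e1]
          _ ≤ _ := by
              have : n + N + 1 = N + (n + 1) := by ring
              rw [this]
              gcongr
              exact hanti (by omega)
      calc _ ≤ (a (N + (n + 1)) + a N * (1 - a (n + N + 1) / a (n + N))) + _ := by gcongr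
        _ = _ := by ring
  have key2 : ∀ n, a N ≤ a (N + n) + a N / 2 := by
    intro n
    refine (key n).trans ?_
    gcongr
    rw [div_eq_mul_inv]
    gcongr
    exact (ENNReal.sum_le_tsum _).trans hN
  have key3 : ∀ n, a N / 2 ≤ a n := by
    intro n
    have h5 : a N / 2 ≤ a (N + n) := by
      have := key2 n
      rw [← tsub_le_iff_right] at this
      rwa [ENNReal.sub_half (hat N)] at this
    exact h5.trans (hanti (by omega))
  have := le_iInf key3
  rw [hinf] at this
  have h0 := ha0 N
  simp at this
  exact h0 this

lemma runMin_le (h : S → ENNReal) (ω : ℕ → S) (t : ℕ) : ∀ i ≤ t, runMin h ω t ≤ h (ω i) := by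
  induction t with
  | zero => intro i hi; simp at hi; subst hi; exact le_rfl
  | succ n ih =>
    intro i hi
    rcases Nat.lt_or_ge i (n + 1) with h1 | h1
    · exact (min_le_left _ _).trans (ih i (by omega))
    · have : i = n + 1 := by omega
      subst this; exact min_le_right _ _

lemma runMin_congr (h : S → ENNReal) (ω v : ℕ → S) (t : ℕ) (hv : ∀ i ≤ t, ω i = v i) :
    runMin h ω t = runMin h v t := by
  induction t with
  | zero => simp [runMin, hv]
  | succ n ih => rw [runMin, runMin, ih (fun i hi => hv i (by omega)), hv (n + 1) le_rfl]

lemma runMin_ne_zero (h : S → ENNReal) (h0 : ∀ s, h s ≠ 0) (ω : ℕ → S) (t : ℕ) :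
    runMin h ω t ≠ 0 := by
  induction t with
  | zero => exact h0 _
  | succ n ih => rw [runMin]; rcases min_choice (runMin h ω n) (h (ω (n + 1))) with e | e <;> rw [e]
                 · exact ih
                 · exact h0 _

lemma runMin_ne_top (h : S → ENNReal) (h0 : ∀ s, h s ≠ ⊤) (ω : ℕ → S) (t : ℕ) :
    runMin h ω t ≠ ⊤ := ne_top_of_le_ne_top (h0 (ω 0)) (runMin_le h ω t 0 (Nat.zero_le _))

lemma path_sum_top (h : S → ENNReal) (h0 : ∀ s, h s ≠ 0) (ht : ∀ s, h s ≠ ⊤) (ω : ℕ → S)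
    (hinf : ⨅ n, h (ω n) = 0) : ∑' n, (1 - h (ω (n + 1)) / runMin h ω n) = ⊤ := by
  rw [← sum_ratio_top (runMin h ω) (runMin_ne_zero h h0 ω) (runMin_ne_top h ht ω)
    (antitone_nat_of_succ_le fun n => min_le_left _ _)
    (le_antisymm (hinf ▸ le_iInf fun n => (iInf_le _ n).trans (runMin_le h ω n n le_rfl)) bot_le)]
  congr 1; ext n
  rw [runMin]
  rcases le_total (runMin h ω n) (h (ω (n + 1))) with e | e
  · rw [min_eq_left e, ENNReal.div_self (runMin_ne_zero h h0 ω n) (runMin_ne_top h ht ω n),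
      tsub_self, tsub_eq_zero_iff_le]
    rw [ENNReal.le_div_iff_mul_le (Or.inl (runMin_ne_zero h h0 ω n))
      (Or.inl (runMin_ne_top h ht ω n)), one_mul]
    exact e
  · rw [min_eq_right e]

section Measure

variable [MeasurableSpace S] [MeasurableSingletonClass S] [Countable S]

lemma meas_eval (n : ℕ) (s : Set S) : MeasurableSet {ω : ℕ → S | ω n ∈ s} :=
  measurable_pi_apply n s.to_countable.measurableSet

lemma meas_comp (h : S → ENNReal) (n : ℕ) : Measurable fun ω : ℕ → S => h (ω n) :=
  (measurable_of_countable h).comp (measurable_pi_apply n)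

lemma meas_cyl (n : ℕ) (v : ℕ → S) : MeasurableSet (cyl n v) := by
  have : cyl n v = ⋂ i, ⋂ (_ : i ≤ n), {ω : ℕ → S | ω i ∈ ({v i} : Set S)} := by
    ext ω; simp [cyl]
  rw [this]
  exact MeasurableSet.iInter fun i => MeasurableSet.iInter fun _ => meas_eval i _

lemma meas_runMin (h : S → ENNReal) (t : ℕ) : Measurable fun ω : ℕ → S => runMin h ω t := by
  induction t with
  | zero => exact meas_comp h 0
  | succ n ih => exact ih.min (meas_comp h (n + 1))

lemma lintegral_le_of_cyl (μ : Measure (ℕ → S)) (t : ℕ) (F G : (ℕ → S) → ENNReal)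
    (hFG : ∀ v, ∫⁻ ω in cyl t v, F ω ∂μ ≤ ∫⁻ ω in cyl t v, G ω ∂μ) :
    ∫⁻ ω, F ω ∂μ ≤ ∫⁻ ω, G ω ∂μ := by
  rcases isEmpty_or_nonempty S with hS | ⟨⟨x⟩⟩
  · have : IsEmpty (ℕ → S) := ⟨fun f => hS.false (f 0)⟩
    simp [Measure.eq_zero_of_isEmpty μ]
  let e : (Fin (t + 1) → S) → ℕ → S := fun a i => if hi : i < t + 1 then a ⟨i, hi⟩ else x
  have hU : (⋃ a, cyl t (e a)) = Set.univ := by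
    ext ω
    simp only [Set.mem_iUnion, Set.mem_univ, iff_true]
    refine ⟨fun i => ω i, fun i hi => ?_⟩
    simp only [e, dif_pos (Nat.lt_succ_of_le hi)]
  have hD : Pairwise (Function.onFun Disjoint fun a => cyl t (e a)) := by
    intro a b hab
    rw [Function.onFun, Set.disjoint_left]
    intro ω ha hb
    apply hab
    ext i
    have h1 := ha i (by omega)
    have h2 := hb i (by omega)
    simp only [e, i.2, dif_pos] at h1 h2
    exact h1.symm.trans h2
  rw [← setLIntegral_univ F, ← setLIntegral_univ G, ← hU,
    lintegral_iUnion (fun a => meas_cyl t _) hD, lintegral_iUnion (fun a => meas_cyl t _) hD]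
  exact ENNReal.tsum_le_tsum fun a => hFG _

lemma cyl_split (μ : Measure (ℕ → S)) (t : ℕ) (v : ℕ → S) (B : Set (ℕ → S))
    (hB : MeasurableSet B) :
    μ (cyl t v ∩ B) = ∑' u, μ (cyl (t + 1) (Function.update v (t + 1) u) ∩ B) := by
  rw [← measure_iUnion]
  · congr 1
    ext ω
    simp only [Set.mem_inter_iff, Set.mem_iUnion, cyl, Set.mem_setOf_eq]
    constructor
    · rintro ⟨h1, h2⟩
      refine ⟨ω (t + 1), fun i hi => ?_, h2⟩
      by_cases e : i = t + 1
      · subst e; simp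
      · rw [Function.update_of_ne e]; exact h1 i (by omega)
    · rintro ⟨u, h1, h2⟩
      refine ⟨fun i hi => ?_, h2⟩
      rw [h1 i (by omega), Function.update_of_ne (by omega)]
  · intro a b hab
    rw [Function.onFun, Set.disjoint_left]
    rintro ω ⟨ha, -⟩ ⟨hb, -⟩
    apply hab
    have h1 := ha (t + 1) le_rfl
    have h2 := hb (t + 1) le_rfl
    simp at h1 h2
    exact h1.symm.trans h2
  · intro u
    exact (meas_cyl _ _).inter hB

lemma cyl_succ (p : S → S → ENNReal) (x₀ : S) (μ : Measure (ℕ → S)) (hμ : IsMarkovChain p x₀ μ)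
    (t : ℕ) (v : ℕ → S) (u : S) :
    μ (cyl (t + 1) (Function.update v (t + 1) u)) = μ (cyl t v) * p (v t) u := by
  have h := hμ.2.2 t (Function.update v (t + 1) u)
  have e : {ω : ℕ → S | ∀ i ≤ t, ω i = Function.update v (t + 1) u i} = cyl t v := by
    ext ω
    simp only [cyl, Set.mem_setOf_eq]
    refine forall_congr' fun i => forall_congr' fun hi => ?_
    rw [Function.update_of_ne (by omega)]
  rw [e] at h
  simpa [cyl] using h

/-- visiting `s` after time `t` -/
def visit (s : S) (t : ℕ) : Set (ℕ → S) := {ω | ∃ r, t ≤ r ∧ ω r = s}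

lemma meas_visit (s : S) (t : ℕ) : MeasurableSet (visit s t) := by
  have : visit s t = ⋃ i, ⋃ (_ : t ≤ i), {ω : ℕ → S | ω i ∈ ({s} : Set S)} := by
    ext ω; simp [visit]
  rw [this]
  exact MeasurableSet.iUnion fun i => MeasurableSet.iUnion fun _ => meas_eval i _

lemma hitN_cyl (p : S → S → ENNReal) (x₀ : S) (μ : Measure (ℕ → S)) (hμ : IsMarkovChain p x₀ μ)
    (s : S) (n : ℕ) : ∀ t v, μ (cyl t v) * hitN p s n (v t) ≤ μ (cyl t v ∩ visit s t) := by
  have hs : ∀ t v, v t = s → cyl t v ∩ visit s t = cyl t v := by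
    intro t v hv
    refine Set.inter_eq_left.2 fun ω hω => ⟨t, le_rfl, ?_⟩
    rw [hω t le_rfl, hv]
  induction n with
  | zero =>
    intro t v
    by_cases hv : v t = s
    · rw [hs t v hv]; simp [hitN, hv]
    · simp [hitN, hv]
  | succ n ih =>
    intro t v
    by_cases hv : v t = s
    · rw [hs t v hv]; simp [hitN, hv]
    · simp only [hitN, hv, if_false]
      rw [← ENNReal.tsum_mul_left, cyl_split μ t v _ (meas_visit s t)]
      refine ENNReal.tsum_le_tsum fun u => ?_
      rw [← mul_assoc, ← cyl_succ p x₀ μ hμ]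
      have := ih (t + 1) (Function.update v (t + 1) u)
      rw [Function.update_self] at this
      refine this.trans (measure_mono (Set.inter_subset_inter_right _ ?_))
      rintro ω ⟨r, hr, e⟩
      exact ⟨r, by omega, e⟩

lemma setLIntegral_cyl (μ : Measure (ℕ → S)) (t : ℕ) (v : ℕ → S) (F : (ℕ → S) → ENNReal)
    (c : ENNReal) (hF : ∀ ω ∈ cyl t v, F ω = c) : ∫⁻ ω in cyl t v, F ω ∂μ = c * μ (cyl t v) := by
  rw [setLIntegral_congr_fun (meas_cyl t v) hF, setLIntegral_const]

lemma setLIntegral_cyl_ind (μ : Measure (ℕ → S)) (t : ℕ) (v : ℕ → S) (B : Set (ℕ → S))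
    (hB : MeasurableSet B) :
    ∫⁻ ω in cyl t v, B.indicator 1 ω ∂μ = μ (cyl t v ∩ B) := by
  rw [lintegral_indicator_one hB, Measure.restrict_apply hB, Set.inter_comm]

lemma lintegral_hit_le (p : S → S → ENNReal) (x₀ : S) (μ : Measure (ℕ → S))
    (hμ : IsMarkovChain p x₀ μ) (s : S) (t : ℕ) :
    ∫⁻ ω, hit p s (ω t) ∂μ ≤ μ (visit s t) := by
  rw [← lintegral_indicator_one (meas_visit s t)]
  refine lintegral_le_of_cyl μ t _ _ fun v => ?_
  rw [setLIntegral_cyl_ind _ _ _ _ (meas_visit s t),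
    setLIntegral_cyl μ t v _ (hit p s (v t)) (fun ω hω => by rw [hω t le_rfl])]
  rw [mul_comm, hit, ENNReal.mul_iSup]
  exact iSup_le fun n => hitN_cyl p x₀ μ hμ s n t v

lemma visit_tendsto (μ : Measure (ℕ → S)) [IsProbabilityMeasure μ] (s : S)
    (hs : ∀ᵐ ω ∂μ, {n : ℕ | ω n = s}.Finite) :
    Filter.Tendsto (fun t => μ (visit s t)) Filter.atTop (nhds 0) := by
  have h := tendsto_measure_iInter_atTop (μ := μ) (s := fun t => visit s t)
    (fun t => (meas_visit s t).nullMeasurableSet)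
    (fun a b hab ω hω => by obtain ⟨r, hr, e⟩ := hω; exact ⟨r, hab.trans hr, e⟩)
    ⟨0, measure_ne_top _ _⟩
  have h0 : μ (⋂ t, visit s t) = 0 := by
    refine measure_mono_null ?_ (ae_iff.1 hs)
    intro ω hω hfin
    obtain ⟨N, hN⟩ := hfin.bddAbove
    obtain ⟨r, hr, e⟩ := Set.mem_iInter.1 hω (N + 1)
    have := hN (show r ∈ {n : ℕ | ω n = s} from e)
    omega
  rwa [h0] at h

/-- maximal inequality, finite horizon -/
lemma maximalN (p : S → S → ENNReal) (x₀ : S) (μ : Measure (ℕ → S)) (hμ : IsMarkovChain p x₀ μ)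
    (h : S → ENNReal) (hsup : ∀ u, ∑' v, p u v * h v ≤ h u) (c : ENNReal) (n : ℕ) :
    ∀ t v, c * μ (cyl t v ∩ {ω | ∃ j, t ≤ j ∧ j ≤ t + n ∧ c ≤ h (ω j)})
      ≤ μ (cyl t v) * h (v t) := by
  have hbig : ∀ t v B, c ≤ h (v t) → c * μ (cyl t v ∩ B) ≤ μ (cyl t v) * h (v t) := by
    intro t v B hc
    rw [mul_comm]
    exact mul_le_mul' (measure_mono Set.inter_subset_left) hc
  have hmeas : ∀ t n, MeasurableSet {ω : ℕ → S | ∃ j, t ≤ j ∧ j ≤ t + n ∧ c ≤ h (ω j)} := by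
    intro t n
    have : {ω : ℕ → S | ∃ j, t ≤ j ∧ j ≤ t + n ∧ c ≤ h (ω j)}
      = ⋃ j, ⋃ (_ : t ≤ j ∧ j ≤ t + n), {ω : ℕ → S | ω j ∈ {s : S | c ≤ h s}} := by
      ext ω; simp [and_assoc]
    rw [this]
    exact MeasurableSet.iUnion fun i => MeasurableSet.iUnion fun _ => meas_eval i _
  induction n with
  | zero =>
    intro t v
    by_cases hc : c ≤ h (v t)
    · exact hbig t v _ hc
    · have : cyl t v ∩ {ω | ∃ j, t ≤ j ∧ j ≤ t + 0 ∧ c ≤ h (ω j)} = ∅ := by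
        ext ω
        simp only [Set.mem_inter_iff, Set.mem_setOf_eq, Set.mem_empty_iff_false, iff_false]
        rintro ⟨h1, j, h2, h3, h4⟩
        have : j = t := by omega
        subst this
        rw [h1 j le_rfl] at h4
        exact hc h4
      rw [this]; simp
  | succ n ih =>
    intro t v
    by_cases hc : c ≤ h (v t)
    · exact hbig t v _ hc
    · rw [cyl_split μ t v _ (hmeas t (n + 1)), ← ENNReal.tsum_mul_left]
      calc _ ≤ ∑' u, μ (cyl t v) * (p (v t) u * h u) := by
            refine ENNReal.tsum_le_tsum fun u => ?_
            rw [← mul_assoc, ← cyl_succ p x₀ μ hμ]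
            have := ih (t + 1) (Function.update v (t + 1) u)
            rw [Function.update_self] at this
            refine le_trans ?_ this
            gcongr c * μ ?_
            rintro ω ⟨h1, j, h2, h3, h4⟩
            refine ⟨h1, j, ?_, by omega, h4⟩
            rcases Nat.lt_or_ge t j with e | e
            · exact e
            · have : j = t := by omega
              subst this
              rw [h1 j (by omega), Function.update_of_ne (by omega)] at h4
              exact absurd h4 hc
        _ ≤ _ := by
            rw [ENNReal.tsum_mul_left]
            gcongr
            exact hsup _

lemma maximal (p : S → S → ENNReal) (x₀ : S) (μ : Measure (ℕ → S)) (hμ : IsMarkovChain p x₀ μ)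
    (h : S → ENNReal) (hsup : ∀ u, ∑' v, p u v * h v ≤ h u) (c : ENNReal) (t : ℕ) (v : ℕ → S) :
    c * μ (cyl t v ∩ {ω | ∃ j, t ≤ j ∧ c ≤ h (ω j)}) ≤ μ (cyl t v) * h (v t) := by
  have e : cyl t v ∩ {ω | ∃ j, t ≤ j ∧ c ≤ h (ω j)}
      = ⋃ n, cyl t v ∩ {ω | ∃ j, t ≤ j ∧ j ≤ t + n ∧ c ≤ h (ω j)} := by
    ext ω
    simp only [Set.mem_inter_iff, Set.mem_iUnion, Set.mem_setOf_eq]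
    constructor
    · rintro ⟨h1, j, h2, h3⟩
      exact ⟨j, h1, j, h2, by omega, h3⟩
    · rintro ⟨n, h1, j, h2, h3, h4⟩
      exact ⟨h1, j, h2, h4⟩
  rw [e, Monotone.measure_iUnion, ENNReal.mul_iSup]
  · exact iSup_le fun n => maximalN p x₀ μ hμ h hsup c n t v
  · rintro a b hab ω ⟨h1, j, h2, h3, h4⟩
    exact ⟨h1, j, h2, by omega, h4⟩

/-- the good event -/
def good (h : S → ENNReal) (t : ℕ) : Set (ℕ → S) := {ω | ∀ j, t < j → h (ω j) < runMin h ω t}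

lemma meas_good (h : S → ENNReal) (t : ℕ) : MeasurableSet (good h t) := by
  have : good h t = ⋂ j, ⋂ (_ : t < j), {ω : ℕ → S | h (ω j) < runMin h ω t} := by
    ext ω; simp [good]
  rw [this]
  exact MeasurableSet.iInter fun i => MeasurableSet.iInter fun _ =>
    measurableSet_lt (meas_comp h i) (meas_runMin h t)

lemma good_lower (p : S → S → ENNReal) (x₀ : S) (μ : Measure (ℕ → S)) (hμ : IsMarkovChain p x₀ μ)
    (h : S → ENNReal) (hsup : ∀ u, ∑' v, p u v * h v ≤ h u) (h0 : ∀ s, h s ≠ 0)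
    (ht : ∀ s, h s ≠ ⊤) (t : ℕ) :
    ∫⁻ ω, (1 - h (ω (t + 1)) / runMin h ω t) ∂μ ≤ μ (good h t) := by
  have := hμ.1
  rw [← lintegral_indicator_one (meas_good h t)]
  refine lintegral_le_of_cyl μ (t + 1) _ _ fun v => ?_
  rw [setLIntegral_cyl_ind _ _ _ _ (meas_good h t),
    setLIntegral_cyl μ (t + 1) v _ (1 - h (v (t + 1)) / runMin h v t)
      (fun ω hω => by
        rw [hω (t + 1) le_rfl, runMin_congr h ω v t (fun i hi => hω i (by omega))])]
  set c := runMin h v t with hc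
  have c0 : c ≠ 0 := runMin_ne_zero h h0 v t
  have ct : c ≠ ⊤ := runMin_ne_top h ht v t
  have hm := maximal p x₀ μ hμ h hsup c (t + 1) v
  have hm2 : μ (cyl (t + 1) v ∩ {ω | ∃ j, t + 1 ≤ j ∧ c ≤ h (ω j)})
      ≤ h (v (t + 1)) / c * μ (cyl (t + 1) v) := by
    rw [← ENNReal.mul_div_right_comm, ENNReal.le_div_iff_mul_le (Or.inl c0) (Or.inl ct)]
    rw [mul_comm, mul_comm (h _)]
    exact hm
  rw [ENNReal.sub_mul (fun _ _ => measure_ne_top _ _), one_mul, tsub_le_iff_right]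
  refine le_trans ?_ (add_le_add_right hm2 _)
  refine le_trans (measure_mono ?_) (measure_union_le _ _)
  intro ω hω
  by_cases hg : ω ∈ good h t
  · exact Or.inl ⟨hω, hg⟩
  · refine Or.inr ⟨hω, ?_⟩
    simp only [good, Set.mem_setOf_eq, not_forall, not_lt] at hg
    obtain ⟨j, hj, hle⟩ := hg
    refine ⟨j, hj, ?_⟩
    rwa [runMin_congr h ω v t (fun i hi => hω i (by omega))] at hle

lemma good_subset (h : S → ENNReal) (t : ℕ) :
    good h t ⊆ {ω | ∀ i ≤ t, ∀ j, t < j → ω i ≠ ω j} := by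
  intro ω hω i hi j hj e
  have h1 := hω j hj
  have h2 := runMin_le h ω t i hi
  rw [e] at h2
  exact absurd h1 (not_lt.2 h2)

lemma ae_inf_zero (p : S → S → ENNReal) (x₀ : S) (μ : Measure (ℕ → S)) (hμ : IsMarkovChain p x₀ μ)
    (htransient : ∀ s : S, ∀ᵐ ω ∂μ, {n : ℕ | ω n = s}.Finite)
    (w : S → ENNReal) (hw : ∑' s, w s ≠ ⊤) :
    ∀ᵐ ω ∂μ, ⨅ n, (∑' s, w s * hit p s (ω n)) = 0 := by
  have := hμ.1
  have hmeas : Measurable fun ω : ℕ → S => ⨅ n, (∑' s, w s * hit p s (ω n)) :=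
    Measurable.iInf fun n => meas_comp (fun u => ∑' s, w s * hit p s u) n
  have hlim : Filter.Tendsto (fun t => ∑' s, w s * μ (visit s t)) Filter.atTop (nhds 0) := by
    have := tendsto_lintegral_of_dominated_convergence (μ := (Measure.count : Measure S))
      (F := fun t s => w s * μ (visit s t)) (f := fun _ => 0) w
      (fun n => measurable_of_countable _)
      (fun n => Filter.Eventually.of_forall fun s => by
        simpa using mul_le_mul_right (prob_le_one (μ := μ) (s := visit s n)) (w s))
      (by rwa [lintegral_count])
      (Filter.Eventually.of_forall fun s => by
        have := ENNReal.Tendsto.const_mul (a := w s) (visit_tendsto μ s (htransient s))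
          (Or.inr (ENNReal.ne_top_of_tsum_ne_top hw s))
        simpa using this)
    simpa [lintegral_count] using this
  have hle : ∀ t, ∫⁻ ω, ⨅ n, (∑' s, w s * hit p s (ω n)) ∂μ ≤ ∑' s, w s * μ (visit s t) := by
    intro t
    calc _ ≤ ∫⁻ ω, (∑' s, w s * hit p s (ω t)) ∂μ := lintegral_mono fun ω => iInf_le _ t
      _ = ∑' s, ∫⁻ ω, w s * hit p s (ω t) ∂μ :=
          lintegral_tsum fun s => (meas_comp (fun u => w s * hit p s u) t).aemeasurable
      _ ≤ _ := by
          refine ENNReal.tsum_le_tsum fun s => ?_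
          rw [lintegral_const_mul _ (meas_comp (hit p s) t)]
          gcongr
          exact lintegral_hit_le p x₀ μ hμ s t
  have h0 : ∫⁻ ω, ⨅ n, (∑' s, w s * hit p s (ω n)) ∂μ = 0 :=
    le_antisymm (ge_of_tendsto' hlim hle) bot_le
  exact (lintegral_eq_zero_iff hmeas).1 h0

end Measure

end CutTimes

/-- For every transient Markov chain on a countable state space, started at
any fixed state, the sum over `t` of the probability that `t` is a cut-time diverges; i.e.
the expected number of cut-times is infinite.  A time `t` is a cut-time of the trajectory
`ω` when `{ω 0, …, ω t} ∩ {ω (t+1), ω (t+2), …} = ∅`. -/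
theorem expected_cut_times_infinite
    {S : Type*} [MeasurableSpace S] [MeasurableSingletonClass S] [Countable S]
    (p : S → S → ENNReal) (hp : ∀ s : S, ∑' t : S, p s t = 1)
    (x₀ : S) (μ : Measure (ℕ → S)) (hμ : IsMarkovChain p x₀ μ)
    (htransient : ∀ s : S, ∀ᵐ ω ∂μ, {n : ℕ | ω n = s}.Finite) :
    ∑' t : ℕ, μ {ω | ∀ i ≤ t, ∀ j, t < j → ω i ≠ ω j} = ⊤ := by
  have := hμ.1
  obtain ⟨w, hw0, hw1⟩ := ENNReal.exists_pos_sum_of_countable' (ε := 1) (by simp) S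
  have hw : ∑' s, w s ≠ ⊤ := (hw1.trans ENNReal.one_lt_top).ne
  set h : S → ENNReal := fun u => ∑' s, w s * CutTimes.hit p s u with hh
  have h0 : ∀ s, h s ≠ 0 := by
    intro s hs
    have h1 := ENNReal.tsum_eq_zero.1 hs s
    rw [CutTimes.hit_self, mul_one] at h1
    exact (hw0 s).ne' h1
  have ht : ∀ s, h s ≠ ⊤ := by
    intro u
    refine ne_top_of_le_ne_top hw (ENNReal.tsum_le_tsum fun s => ?_)
    simpa using mul_le_mul_right (CutTimes.hit_le_one p hp s u) (w s)
  have hsup : ∀ u, ∑' v, p u v * h v ≤ h u := by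
    intro u
    simp only [hh, ← ENNReal.tsum_mul_left]
    rw [ENNReal.tsum_comm]
    refine ENNReal.tsum_le_tsum fun s => ?_
    calc ∑' v, p u v * (w s * CutTimes.hit p s v) = w s * ∑' v, p u v * CutTimes.hit p s v := by
          rw [← ENNReal.tsum_mul_left]
          exact tsum_congr fun v => by ring
      _ ≤ _ := by
          gcongr
          exact CutTimes.hit_super p hp s u
  have hinf := CutTimes.ae_inf_zero p x₀ μ hμ htransient w hw
  rw [eq_top_iff]
  calc (⊤ : ENNReal) = ∫⁻ ω, ∑' t, (1 - h (ω (t + 1)) / CutTimes.runMin h ω t) ∂μ := by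
        rw [lintegral_congr_ae (g := fun _ => ⊤)]
        · simp
        · filter_upwards [hinf] with ω hω
          exact CutTimes.path_sum_top h h0 ht ω hω
    _ = ∑' t, ∫⁻ ω, (1 - h (ω (t + 1)) / CutTimes.runMin h ω t) ∂μ := by
        refine lintegral_tsum fun t => Measurable.aemeasurable ?_
        exact measurable_const.sub
          ((CutTimes.meas_comp h (t + 1)).div (CutTimes.meas_runMin h t))
    _ ≤ _ := ENNReal.tsum_le_tsum fun t =>
        (CutTimes.good_lower p x₀ μ hμ h hsup h0 ht t).trans
          (measure_mono (CutTimes.good_subset h t))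
end

section
/- Consider the network random walk on ℕ with positive edge conductances w(i, i+1) between consecutive integers and arbitrary nonnegative self-loop weights w(i, i), and set r_i = 1/w(i, i+1) and η_j = Σ_{i≥j} r_i. Assume η_0 < ∞. Then for every j ∈ ℕ, the probability that the walk started at j ever visits 0 equals η_j/η_0. -/
open MeasureTheory

/-- The transition probabilities of the network random walk on `ℕ` with edge conductances
`w i` between `i` and `i+1` and self-loop weights `ℓ i` at `i`. -/
noncomputable def networkKernel (w ℓ : ℕ → ℝ) : ℕ → ℕ → ENNReal := fun i j =>
  if i = 0 then
    if j = 1 then ENNReal.ofReal (w 0 / (ℓ 0 + w 0))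
    else if j = 0 then ENNReal.ofReal (ℓ 0 / (ℓ 0 + w 0))
    else 0
  else
    if j = i + 1 then ENNReal.ofReal (w i / (w (i - 1) + ℓ i + w i))
    else if j = i - 1 then ENNReal.ofReal (w (i - 1) / (w (i - 1) + ℓ i + w i))
    else if j = i then ENNReal.ofReal (ℓ i / (w (i - 1) + ℓ i + w i))
    else 0

namespace NetWalk

/-- The walk stopped upon reaching `0`. -/
def y : ℕ → (ℕ → ℕ) → ℕ
  | 0, ω => ω 0
  | n + 1, ω => if y n ω = 0 then 0 else ω (n + 1)

lemma y_eq_zero (n : ℕ) (ω : ℕ → ℕ) : y n ω = 0 ↔ ∃ i ≤ n, ω i = 0 := by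
  induction n with
  | zero => simp [y]
  | succ n ih =>
    by_cases h : y n ω = 0
    · obtain ⟨i, hi, h0⟩ := ih.1 h
      simp only [y, h, if_true, true_iff]
      exact ⟨i, by omega, h0⟩
    · simp only [y, h, if_false]
      constructor
      · intro h1; exact ⟨n + 1, le_rfl, h1⟩
      · rintro ⟨i, hi, h0⟩
        rcases Nat.lt_or_ge n i with h2 | h2
        · have : i = n + 1 := by omega
          rw [← this]; exact h0
        · exact absurd (ih.2 ⟨i, h2, h0⟩) h

lemma y_eq (n : ℕ) (ω : ℕ → ℕ) (h : y n ω ≠ 0) : y n ω = ω n := by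
  cases n with
  | zero => rfl
  | succ n =>
    by_cases h' : y n ω = 0
    · simp [y, h'] at h
    · simp [y, h']

lemma y_congr (n : ℕ) (ω ω' : ℕ → ℕ) (h : ∀ i ≤ n, ω i = ω' i) : y n ω = y n ω' := by
  induction n with
  | zero => exact h 0 le_rfl
  | succ n ih =>
    simp only [y]
    rw [ih (fun i hi => h i (by omega)), h (n + 1) le_rfl]

lemma measurable_y (n : ℕ) : Measurable (y n) := by
  induction n with
  | zero => exact measurable_pi_apply 0
  | succ n ih =>
    exact Measurable.ite (ih (measurableSet_singleton 0)) measurable_const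
      (measurable_pi_apply (n + 1))

lemma decomp {Ω α : Type*} [MeasurableSpace Ω] [Countable α] [MeasurableSpace α]
    [MeasurableSingletonClass α] (μ : Measure Ω) (f : Ω → α) (hf : Measurable f)
    (s : Set Ω) (hs : MeasurableSet s) : μ s = ∑' v, μ (s ∩ f ⁻¹' {v}) := by
  rw [← measure_iUnion]
  · congr 1
    ext x; simp
  · intro a b hab
    refine Set.disjoint_left.2 ?_
    rintro x ⟨_, h1⟩ ⟨_, h2⟩
    exact hab (by simp at h1 h2; rw [← h1, ← h2])
  · intro v
    exact hs.inter (hf (measurableSet_singleton v))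

lemma markov {p : ℕ → ℕ → ENNReal} {j : ℕ} {μ : Measure (ℕ → ℕ)} (hμ : IsMarkovChain p j μ)
    (n l k : ℕ) (hl : l ≠ 0) :
    μ ({ω | y n ω = l} ∩ {ω | ω (n + 1) = k}) = μ {ω | y n ω = l} * p l k := by
  have hm1 : MeasurableSet {ω : ℕ → ℕ | y n ω = l} := measurable_y n (measurableSet_singleton l)
  have hm2 : MeasurableSet {ω : ℕ → ℕ | ω (n + 1) = k} :=
    (measurable_pi_apply (n + 1) : Measurable fun ω : ℕ → ℕ => ω (n + 1))
      (measurableSet_singleton k)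
  let f : (ℕ → ℕ) → (Fin (n + 1) → ℕ) := fun ω i => ω i
  have hf : Measurable f := by fun_prop
  rw [decomp μ f hf _ (hm1.inter hm2), decomp μ f hf _ hm1, ← ENNReal.tsum_mul_right]
  refine tsum_congr fun v => ?_
  let v' : ℕ → ℕ := fun i => if h : i < n + 1 then v ⟨i, h⟩ else k
  have hfv : ∀ ω, f ω = v ↔ ∀ i ≤ n, ω i = v' i := by
    intro ω
    constructor
    · rintro h i hi
      have : i < n + 1 := by omega
      simp only [v', this, dif_pos, ← h, f]
    · intro h
      ext i
      have := h i (by omega)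
      simp only [v', i.2, dif_pos] at this
      exact this
  have hk : v' (n + 1) = k := by simp [v']
  by_cases hv : y n v' = l
  · have hvn : v' n = l := by rw [← y_eq n v' (by rw [hv]; exact hl), hv]
    have e1 : {ω | y n ω = l} ∩ {ω | ω (n + 1) = k} ∩ f ⁻¹' {v}
        = {ω | ∀ i ≤ n + 1, ω i = v' i} := by
      ext ω
      simp only [Set.mem_inter_iff, Set.mem_ofPred_eq, Set.mem_preimage, Set.mem_singleton_iff, hfv]
      constructor
      · rintro ⟨⟨_, h2⟩, h3⟩ i hi
        rcases Nat.lt_or_ge n i with h | h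
        · have : i = n + 1 := by omega
          rw [this, hk, h2]
        · exact h3 i h
      · intro h
        have h' : ∀ i ≤ n, ω i = v' i := fun i hi => h i (by omega)
        exact ⟨⟨by rw [y_congr n ω v' h', hv], by rw [h _ le_rfl, hk]⟩, h'⟩
    have e2 : {ω | y n ω = l} ∩ f ⁻¹' {v} = {ω | ∀ i ≤ n, ω i = v' i} := by
      ext ω
      simp only [Set.mem_inter_iff, Set.mem_ofPred_eq, Set.mem_preimage, Set.mem_singleton_iff, hfv]
      exact ⟨fun h => h.2, fun h => ⟨by rw [y_congr n ω v' h, hv], h⟩⟩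
    rw [e1, e2, hμ.2.2 n v', hvn, hk]
  · have e2 : {ω | y n ω = l} ∩ f ⁻¹' {v} = ∅ := by
      ext ω
      simp only [Set.mem_inter_iff, Set.mem_ofPred_eq, Set.mem_preimage, Set.mem_singleton_iff, hfv,
        Set.mem_empty_iff_false, iff_false]
      rintro ⟨h1, h2⟩
      exact hv (by rw [← y_congr n ω v' h2, h1])
    have e1 : {ω | y n ω = l} ∩ {ω | ω (n + 1) = k} ∩ f ⁻¹' {v} = ∅ := by
      rw [Set.inter_right_comm, e2, Set.empty_inter]
    rw [e1, e2]; simp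

/-- Transition probabilities of the stopped walk. -/
noncomputable def q (p : ℕ → ℕ → ENNReal) (l k : ℕ) : ENNReal :=
  if l = 0 then (if k = 0 then 1 else 0) else p l k

lemma step {p : ℕ → ℕ → ENNReal} {j : ℕ} {μ : Measure (ℕ → ℕ)} (hμ : IsMarkovChain p j μ)
    (n k : ℕ) : μ {ω | y (n + 1) ω = k} = ∑' l, μ {ω | y n ω = l} * q p l k := by
  have hm : MeasurableSet {ω : ℕ → ℕ | y (n + 1) ω = k} :=
    measurable_y (n + 1) (measurableSet_singleton k)
  rw [decomp μ (y n) (measurable_y n) _ hm]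
  refine tsum_congr fun l => ?_
  by_cases hl : l = 0
  · subst hl
    by_cases hk : k = 0
    · subst hk
      simp only [q, if_true, mul_one]
      congr 1
      ext ω
      simp +contextual [y]
    · simp only [q, if_true, hk, if_false, mul_zero]
      convert measure_empty (μ := μ)
      ext ω
      simp only [y, Set.mem_inter_iff, Set.mem_ofPred_eq, Set.mem_preimage, Set.mem_singleton_iff,
        Set.mem_empty_iff_false, iff_false]
      rintro ⟨h1, h2⟩
      rw [if_pos h2] at h1
      exact hk h1.symm
  · simp only [q, hl, if_false]
    rw [← markov hμ n l k hl]
    congr 1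
    ext ω
    simp only [y, Set.mem_inter_iff, Set.mem_ofPred_eq, Set.mem_preimage, Set.mem_singleton_iff]
    constructor
    · rintro ⟨h1, h2⟩
      rw [if_neg (by omega)] at h1
      exact ⟨h2, h1⟩
    · rintro ⟨h1, h2⟩
      rw [if_neg (by omega)]
      exact ⟨h2, h1⟩

/-- Expectation of `F` along the stopped walk. -/
noncomputable def S (μ : Measure (ℕ → ℕ)) (n : ℕ) (F : ℕ → ENNReal) : ENNReal :=
  ∑' k, μ {ω | y n ω = k} * F k

lemma S_succ {p : ℕ → ℕ → ENNReal} {j : ℕ} {μ : Measure (ℕ → ℕ)} (hμ : IsMarkovChain p j μ)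
    (n : ℕ) (F : ℕ → ENNReal) : S μ (n + 1) F = S μ n (fun l => ∑' k, q p l k * F k) := by
  unfold S
  simp_rw [step hμ n, ← ENNReal.tsum_mul_right, ← ENNReal.tsum_mul_left]
  rw [ENNReal.tsum_comm]
  simp_rw [mul_assoc]

lemma S_zero {p : ℕ → ℕ → ENNReal} {j : ℕ} {μ : Measure (ℕ → ℕ)} (hμ : IsMarkovChain p j μ)
    (F : ℕ → ENNReal) : S μ 0 F = F j := by
  have := hμ.1
  unfold S
  rw [tsum_eq_single j]
  · simp only [y]; rw [hμ.2.1, one_mul]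
  · intro k hk
    have h1 : μ {ω : ℕ → ℕ | ω 0 = j}ᶜ = 0 := by
      have hm : MeasurableSet {ω : ℕ → ℕ | ω 0 = j} :=
        (measurable_pi_apply 0 : Measurable fun ω : ℕ → ℕ => ω 0) (measurableSet_singleton j)
      rw [prob_compl_eq_zero_iff hm]
      exact hμ.2.1
    have h2 : μ {ω : ℕ → ℕ | y 0 ω = k} = 0 := by
      refine measure_mono_null ?_ h1
      intro ω h
      simp only [y, Set.mem_ofPred_eq] at h
      simp only [Set.mem_compl_iff, Set.mem_ofPred_eq, h]
      exact hk
    rw [h2, zero_mul]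

lemma S_one {p : ℕ → ℕ → ENNReal} {j : ℕ} {μ : Measure (ℕ → ℕ)} (hμ : IsMarkovChain p j μ)
    (n : ℕ) : ∑' k, μ {ω | y n ω = k} = 1 := by
  have := hμ.1
  rw [← measure_univ (μ := μ), decomp μ (y n) (measurable_y n) _ MeasurableSet.univ]
  simp only [Set.univ_inter]
  rfl

lemma q_zero (p : ℕ → ℕ → ENNReal) (F : ℕ → ENNReal) : ∑' k, q p 0 k * F k = F 0 := by
  rw [tsum_eq_single 0]
  · simp [q]
  · intro k hk; simp [q, hk]

lemma q_succ (w ℓ : ℕ → ℝ) (hw : ∀ i, 0 < w i) (hℓ : ∀ i, 0 ≤ ℓ i) (m : ℕ) (f : ℕ → ℝ)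
    (hf : ∀ i, 0 ≤ f i) :
    ∑' k, q (networkKernel w ℓ) (m + 1) k * ENNReal.ofReal (f k) =
      ENNReal.ofReal ((w m * f m + ℓ (m + 1) * f (m + 1) + w (m + 1) * f (m + 2)) /
        (w m + ℓ (m + 1) + w (m + 1))) := by
  have hW : 0 < w m + ℓ (m + 1) + w (m + 1) := by
    have := hw m; have := hw (m + 1); have := hℓ (m + 1); linarith
  have h0 := (hw m).le
  have h1 := (hw (m + 1)).le
  have h2 := hℓ (m + 1)
  have f0 := hf m
  have f1 := hf (m + 1)
  have f2 := hf (m + 2)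
  rw [tsum_eq_sum (s := {m, m + 1, m + 2})]
  · rw [Finset.sum_insert (by simp), Finset.sum_insert (by simp), Finset.sum_singleton]
    simp only [q, networkKernel]
    simp only [Nat.add_eq_zero_iff, one_ne_zero, and_false, if_false, Nat.add_sub_cancel]
    rw [if_neg (show ¬ m = m + 1 + 1 by omega), if_neg (show ¬ m + 1 = m + 1 + 1 by omega),
      if_neg (show ¬ m + 1 = m by omega)]
    simp only [if_true]
    rw [← ENNReal.ofReal_mul (by positivity), ← ENNReal.ofReal_mul (by positivity),
      ← ENNReal.ofReal_mul (by positivity), ← ENNReal.ofReal_add (by positivity) (by positivity),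
      ← ENNReal.ofReal_add (by positivity) (by positivity)]
    congr 1
    field_simp
    ring
  · intro k hk
    simp only [Finset.mem_insert, Finset.mem_singleton, not_or] at hk
    simp only [q, networkKernel]
    rw [if_neg (by omega), if_neg (by omega), if_neg (by omega), if_neg (by omega),
      if_neg (by omega), zero_mul]

/-- The abstract conclusion. -/
lemma main {p : ℕ → ℕ → ENNReal} {j : ℕ} {μ : Measure (ℕ → ℕ)} (hμ : IsMarkovChain p j μ)
    (h g v : ℕ → ENNReal) (h0 : h 0 = 1) (hle : ∀ k, h k ≤ 1) (hanti : Antitone h)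
    (hlim : Filter.Tendsto h Filter.atTop (nhds 0))
    (hgh : ∀ k, g k ≤ h k)
    (hh : ∀ l, ∑' k, q p l k * h k = h l)
    (hg : ∀ l, ∑' k, q p l k * g k = g l + v l) (hv : ∀ l, l ≠ 0 → v l ≠ 0) :
    μ {ω | ∃ t : ℕ, ω t = 0} = h j := by
  have hS : ∀ n, S μ n h = h j := by
    intro n
    induction n with
    | zero => exact S_zero hμ h
    | succ n ih => rw [S_succ hμ]; simp_rw [hh]; exact ih
  have hSg : ∀ n, S μ (n + 1) g = S μ n g + S μ n v := by
    intro n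
    rw [S_succ hμ]; simp_rw [hg]
    unfold S
    rw [← ENNReal.tsum_add]
    simp_rw [mul_add]
  have hsum : ∀ n, ∑ m ∈ Finset.range n, S μ m v ≤ S μ n g := by
    intro n
    induction n with
    | zero => simp
    | succ n ih => rw [Finset.sum_range_succ, hSg]; gcongr
  have hb : ∀ n, S μ n g ≤ 1 := by
    intro n
    refine le_trans ?_ ((hS n).trans_le (hle j))
    exact ENNReal.tsum_le_tsum fun k => by gcongr; exact hgh k
  have ht : ∑' n, S μ n v ≤ 1 := by
    rw [ENNReal.tsum_eq_iSup_nat]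
    exact iSup_le fun n => (hsum n).trans (hb n)
  have ha : ∀ l, l ≠ 0 →
      Filter.Tendsto (fun n => μ {ω | y n ω = l}) Filter.atTop (nhds 0) := by
    intro l hl
    refine ENNReal.tendsto_atTop_zero_of_tsum_ne_top (fun hT => ?_)
    have h1 : (∑' n, μ {ω | y n ω = l}) * v l ≤ 1 := by
      rw [← ENNReal.tsum_mul_right]
      refine le_trans (ENNReal.tsum_le_tsum fun n => ?_) ht
      exact ENNReal.le_tsum (f := fun k => μ {ω | y n ω = k} * v k) l
    rw [hT, ENNReal.top_mul (hv l hl)] at h1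
    simp at h1
  have hH : Filter.Tendsto (fun n => μ {ω | y n ω = 0}) Filter.atTop
      (nhds (μ {ω | ∃ t : ℕ, ω t = 0})) := by
    have : {ω : ℕ → ℕ | ∃ t : ℕ, ω t = 0} = ⋃ n, {ω | y n ω = 0} := by
      ext ω
      simp only [Set.mem_ofPred_eq, Set.mem_iUnion, y_eq_zero]
      exact ⟨fun ⟨t, h⟩ => ⟨t, t, le_rfl, h⟩, fun ⟨_, t, _, h⟩ => ⟨t, h⟩⟩
    rw [this]
    refine tendsto_measure_iUnion_atTop ?_
    intro a b hab ω
    simp only [Set.mem_ofPred_eq, y_eq_zero]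
    exact fun ⟨t, h1, h2⟩ => ⟨t, h1.trans hab, h2⟩
  apply le_antisymm
  · refine le_of_tendsto' hH fun n => ?_
    rw [← hS n]
    have := ENNReal.le_tsum (f := fun k => μ {ω | y n ω = k} * h k) 0
    simpa [h0, S] using this
  · have key : ∀ K n, h j ≤ μ {ω | y n ω = 0} +
        ∑ k ∈ Finset.range K, μ {ω | y n ω = k + 1} + h K := by
      intro K n
      have hK : h j ≤ ∑ k ∈ Finset.range (K + 1), μ {ω | y n ω = k} + h K := by
        rw [← hS n]
        unfold S
        rw [← ENNReal.summable.sum_add_tsum_nat_add' (k := K + 1)]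
        refine add_le_add (Finset.sum_le_sum fun k _ => mul_le_of_le_one_right' (hle k)) ?_
        calc ∑' i, μ {ω | y n ω = i + (K + 1)} * h (i + (K + 1))
            ≤ ∑' i, μ {ω | y n ω = i + (K + 1)} * h K :=
              ENNReal.tsum_le_tsum fun i => by gcongr; exact hanti (by omega)
          _ = (∑' i, μ {ω | y n ω = i + (K + 1)}) * h K := ENNReal.tsum_mul_right
          _ ≤ (∑' i, μ {ω | y n ω = i}) * h K := by
              refine mul_le_mul_left ?_ _
              exact ENNReal.tsum_comp_le_tsum_of_injective
                (add_left_injective (K + 1)) (fun i => μ {ω | y n ω = i})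
          _ = h K := by rw [S_one hμ, one_mul]
      rw [Finset.sum_range_succ', add_comm (∑ k ∈ _, _)] at hK
      exact hK
    have key2 : ∀ K, h j ≤ μ {ω | ∃ t : ℕ, ω t = 0} + h K := by
      intro K
      have h1 : Filter.Tendsto (fun n => μ {ω | y n ω = 0} +
        ∑ k ∈ Finset.range K, μ {ω | y n ω = k + 1} + h K) Filter.atTop
          (nhds (μ {ω | ∃ t : ℕ, ω t = 0} + ∑ k ∈ Finset.range K, 0 + h K)) :=
        (hH.add (tendsto_finsetSum _ fun k _ => ha (k + 1) (by omega))).add tendsto_const_nhds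
      have := ge_of_tendsto' h1 (key K)
      simpa using this
    have h2 := ge_of_tendsto' (tendsto_const_nhds.add hlim) key2
    simpa using h2

end NetWalk

open NetWalk

/-- For the network random walk on `ℕ` with positive edge conductances
`w i = w(i, i+1)` and nonnegative self-loop weights `ℓ i = w(i, i)`, set `r i = 1 / w i`
and `η j = ∑_{i ≥ j} r i`.  If `η 0 < ∞`, then the probability that the walk started at
`j` ever visits `0` equals `η j / η 0`. -/
theorem network_walk_return_probability
    (w ℓ : ℕ → ℝ) (hw : ∀ i, 0 < w i) (hℓ : ∀ i, 0 ≤ ℓ i)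
    (hη : Summable fun i : ℕ => (w i)⁻¹)
    (j : ℕ) (μ : Measure (ℕ → ℕ)) (hμ : IsMarkovChain (networkKernel w ℓ) j μ) :
    μ {ω | ∃ t : ℕ, ω t = 0} =
      ENNReal.ofReal ((∑' i : ℕ, (w (j + i))⁻¹) / ∑' i : ℕ, (w i)⁻¹) := by
  set H : ℝ := ∑' i : ℕ, (w i)⁻¹ with hH
  have hr : ∀ i, 0 < (w i)⁻¹ := fun i => inv_pos.2 (hw i)
  have hsj : ∀ k, Summable fun i : ℕ => (w (k + i))⁻¹ := by
    intro k
    have := (summable_nat_add_iff k).2 hη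
    simpa [add_comm] using this
  have hHpos : 0 < H := hη.tsum_pos (fun i => (hr i).le) 0 (hr 0)
  let η : ℕ → ℝ := fun k => ∑' i : ℕ, (w (k + i))⁻¹
  have hηpos : ∀ k, 0 ≤ η k := fun k => tsum_nonneg fun i => (hr _).le
  have hrec : ∀ k, η k = (w k)⁻¹ + η (k + 1) := by
    intro k
    have := (hsj k).tsum_eq_zero_add
    simp only [η, this, add_zero]
    congr 2
    ext i
    rw [show k + (i + 1) = k + 1 + i by omega]
  have hη0 : η 0 = H := by simp [η, hH]
  have hanti : Antitone η := antitone_nat_of_succ_le fun k => by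
    rw [hrec k]; linarith [hr k]
  have hηle : ∀ k, η k ≤ H := fun k => hη0 ▸ hanti (Nat.zero_le k)
  let f : ℕ → ℝ := fun k => η k / H
  have hf0 : ∀ k, 0 ≤ f k := fun k => div_nonneg (hηpos k) hHpos.le
  have hf1 : ∀ k, f k ≤ 1 := fun k => (div_le_one hHpos).2 (hηle k)
  have hlim : Filter.Tendsto f Filter.atTop (nhds 0) := by
    have h1 : Filter.Tendsto η Filter.atTop (nhds 0) := by
      have := tendsto_sum_nat_add fun i : ℕ => (w i)⁻¹
      simpa [η, add_comm] using this
    simpa using h1.div_const H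
  let V : ℕ → ℝ := fun m => ((w m)⁻¹ + (w (m + 1))⁻¹) / ((w m + ℓ (m + 1) + w (m + 1)) * H ^ 2)
  have hW : ∀ m, 0 < w m + ℓ (m + 1) + w (m + 1) := fun m => by
    have := hw m; have := hw (m + 1); have := hℓ (m + 1); linarith
  have hV : ∀ m, 0 < V m := fun m =>
    div_pos (add_pos (hr _) (hr _)) (mul_pos (hW m) (pow_pos hHpos 2))
  refine main hμ (fun k => ENNReal.ofReal (f k)) (fun k => ENNReal.ofReal (f k ^ 2))
    (fun k => if k = 0 then 0 else ENNReal.ofReal (V (k - 1))) ?_ ?_ ?_ ?_ ?_ ?_ ?_ ?_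
  · simp [f, hη0, hHpos.ne']
  · intro k; exact ENNReal.ofReal_le_one.2 (hf1 k)
  · intro a b hab
    exact ENNReal.ofReal_le_ofReal (div_le_div_of_nonneg_right (hanti hab) hHpos.le)
  · simpa using ENNReal.tendsto_ofReal hlim
  · intro k
    refine ENNReal.ofReal_le_ofReal ?_
    nlinarith [hf0 k, hf1 k]
  · intro l
    cases l with
    | zero => exact q_zero _ _
    | succ m =>
      rw [q_succ w ℓ hw hℓ m f hf0]
      congr 1
      have := hw m; have := hw (m + 1); have := hW m
      simp only [f]
      rw [hrec m, hrec (m + 1)]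
      field_simp
      ring
  · intro l
    cases l with
    | zero => simpa using q_zero _ (fun k => ENNReal.ofReal (f k ^ 2))
    | succ m =>
      rw [q_succ w ℓ hw hℓ m (fun k => f k ^ 2) (fun k => sq_nonneg _)]
      rw [if_neg (by omega), Nat.add_sub_cancel, ← ENNReal.ofReal_add (sq_nonneg _) (hV m).le]
      congr 1
      have := hw m; have := hw (m + 1); have := hW m
      simp only [f, V]
      rw [hrec m, hrec (m + 1)]
      field_simp
      ring
  · intro l hl
    rw [if_neg hl]
    exact (ENNReal.ofReal_pos.2 (hV _)).ne'
end

section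
/- Consider the network random walk on ℕ with positive edge conductances w(i, i+1) and nonnegative self-loop weights w(i, i), and set r_i = 1/w(i, i+1). If Σ_{i≥0} r_i < ∞, then the walk is transient: for every starting state j and every state s ∈ ℕ, almost surely the walk visits s only finitely often. -/
open MeasureTheory

/-- One-step joint law from the cylinder Markov property. -/
lemma nw_joint (p : ℕ → ℕ → ENNReal) (j : ℕ) (μ : Measure (ℕ → ℕ))
    (hμ : IsMarkovChain p j μ) (n i k : ℕ) :
    μ {ω | ω n = i ∧ ω (n + 1) = k} = μ {ω | ω n = i} * p i k := by
  obtain ⟨_, _, hm⟩ := hμ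
  have hms : ∀ t i, MeasurableSet {ω : ℕ → ℕ | ω t = i} := fun t i =>
    measurableSet_eq_fun (measurable_pi_apply t) measurable_const
  let ext : (Fin n → ℕ) → ℕ → ℕ := fun u a =>
    if h : a < n then u ⟨a, h⟩ else if a = n then i else k
  let B : (Fin n → ℕ) → Set (ℕ → ℕ) := fun u => {ω | ∀ a : Fin n, ω a = u a}
  have hB : ∀ u, MeasurableSet (B u) := by
    intro u
    simp only [B, Set.ofPred_forall]
    exact MeasurableSet.iInter fun a => hms _ _
  have key : ∀ A : Set (ℕ → ℕ), MeasurableSet A → μ A = ∑' u : Fin n → ℕ, μ (B u ∩ A) := by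
    intro A hA
    rw [← measure_iUnion]
    · congr 1
      ext ω
      simp only [Set.mem_iUnion, Set.mem_inter_iff]
      exact ⟨fun h => ⟨fun a => ω a, fun a => rfl, h⟩, fun ⟨_, _, h⟩ => h⟩
    · intro u u' huu
      refine Set.disjoint_left.2 fun ω h1 h2 => huu ?_
      funext a
      exact (h1.1 a).symm.trans (h2.1 a)
    · exact fun u => (hB u).inter hA
  have hext : ∀ u (a : Fin n), ext u a = u a := fun u a => by simp [ext]
  have hextn : ∀ u, ext u n = i := fun u => by simp [ext]
  have hextn1 : ∀ u, ext u (n + 1) = k := fun u => by simp [ext]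
  have h1 : ∀ u, B u ∩ {ω | ω n = i} = {ω | ∀ a ≤ n, ω a = ext u a} := by
    intro u
    ext ω
    constructor
    · rintro ⟨hb, hn⟩ a ha
      rcases ha.lt_or_eq with h | rfl
      · exact (hb ⟨a, h⟩).trans (hext u ⟨a, h⟩).symm
      · exact hn.trans (hextn u).symm
    · intro h
      exact ⟨fun a => (h a a.2.le).trans (hext u a), (h n le_rfl).trans (hextn u)⟩
  have h2 : ∀ u, B u ∩ {ω | ω n = i ∧ ω (n + 1) = k} = {ω | ∀ a ≤ n + 1, ω a = ext u a} := by
    intro u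
    have : B u ∩ {ω | ω n = i ∧ ω (n + 1) = k}
        = (B u ∩ {ω | ω n = i}) ∩ {ω | ω (n + 1) = k} := by
      rw [Set.inter_assoc]; rfl
    rw [this, h1]
    ext ω
    constructor
    · rintro ⟨hb, hn⟩ a ha
      rcases Nat.le_succ_iff.1 ha with h | rfl
      · exact hb a h
      · exact hn.trans (hextn1 u).symm
    · intro h
      exact ⟨fun a ha => h a (by omega), (h (n + 1) le_rfl).trans (hextn1 u)⟩
  have hm2 : MeasurableSet {ω : ℕ → ℕ | ω n = i ∧ ω (n + 1) = k} :=
    (hms n i).inter (hms (n + 1) k)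
  rw [key _ (hms n i), key _ hm2, ← ENNReal.tsum_mul_right]
  refine tsum_congr fun u => ?_
  have h3 := hm n (ext u)
  rw [hextn, hextn1, ← h1, ← h2] at h3
  exact h3

lemma nw_green (w ℓ : ℕ → ℝ) (hw : ∀ i, 0 < w i) (hℓ : ∀ i, 0 ≤ ℓ i)
    (hr : Summable fun i : ℕ => (w i)⁻¹) (s : ℕ) :
    ∃ (g : ℕ → ENNReal) (c C : ENNReal), c ≠ 0 ∧ C ≠ ⊤ ∧ (∀ i, g i ≤ C) ∧
      ∀ i, (∑' k, networkKernel w ℓ i k * g k) + (if i = s then c else 0) ≤ g i := by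
  let r : ℕ → ℝ := fun i => (w i)⁻¹
  let R : ℕ → ℝ := fun n => ∑' k, r (k + n)
  have hr0 : ∀ i, 0 < r i := fun i => inv_pos.2 (hw i)
  have hR : ∀ n, R n = r n + R (n + 1) := by
    intro n
    have := ((summable_nat_add_iff n).2 hr).tsum_eq_zero_add
    simp only [zero_add] at this
    simp only [R, r]
    rw [this]
    congr 1
    refine tsum_congr fun k => ?_
    congr 2
    omega
  have hRp : ∀ n, 0 ≤ R n := fun n => tsum_nonneg fun k => (hr0 _).le
  have hanti : Antitone R := antitone_nat_of_succ_le fun n => by linarith [hR n, hr0 n]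
  let G : ℕ → ℝ := fun i => R (max i s)
  have hG0 : ∀ i, 0 ≤ G i := fun i => hRp _
  have hGlt : ∀ i, i < s → G (i + 1) = G i := by
    intro i hi
    simp only [G]
    rw [max_eq_right (by omega), max_eq_right (by omega)]
  have hGge : ∀ i, s ≤ i → G i = r i + G (i + 1) := by
    intro i hi
    simp only [G]
    rw [max_eq_left (by omega), max_eq_left (by omega), hR]
  have hwr : ∀ i, w i * r i = 1 := fun i => mul_inv_cancel₀ (hw i).ne'
  have hflux : ∀ i, w i * G i = w i * G (i + 1) + (if s ≤ i then 1 else 0) := by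
    intro i
    split_ifs with h
    · rw [hGge i h, mul_add, hwr]; ring
    · rw [hGlt i (by omega)]; ring
  let W : ℕ → ℝ := fun i => (if i = 0 then 0 else w (i - 1)) + ℓ i + w i
  have hW : ∀ i, 0 < W i := by
    intro i
    have := hw i
    have := hℓ i
    have := hw (i - 1)
    simp only [W]
    split_ifs <;> linarith
  refine ⟨fun i => ENNReal.ofReal (G i), ENNReal.ofReal (1 / W s), ENNReal.ofReal (R s), ?_,
    ENNReal.ofReal_ne_top, fun i => ENNReal.ofReal_le_ofReal (hanti (le_max_right _ _)), ?_⟩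
  · simpa using hW s
  intro i
  have hc : (if i = s then ENNReal.ofReal (1 / W s) else 0)
      = ENNReal.ofReal ((if i = s then 1 else 0) / W i) := by
    split_ifs with h
    · rw [h]
    · simp
  rw [hc]
  rcases Nat.eq_zero_or_pos i with rfl | hi
  · have hW0 : W 0 = ℓ 0 + w 0 := by simp [W]
    have hp := hW 0
    rw [tsum_eq_sum (s := {0, 1})]
    · rw [Finset.sum_pair (by decide)]
      simp only [networkKernel, if_true, zero_ne_one, if_false, ← hW0]
      rw [← ENNReal.ofReal_mul (div_nonneg (hℓ 0) hp.le),
        ← ENNReal.ofReal_mul (div_nonneg (hw 0).le hp.le),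
        ← ENNReal.ofReal_add, ← ENNReal.ofReal_add]
      · apply ENNReal.ofReal_le_ofReal
        have h0 := hflux 0
        rw [div_mul_eq_mul_div, div_mul_eq_mul_div, ← add_div, ← add_div, div_le_iff₀ hp, hW0]
        have : (if s ≤ 0 then (1 : ℝ) else 0) = if 0 = s then 1 else 0 := by
          congr 1; simp [eq_comm]
        rw [this] at h0
        simp only [zero_add] at h0
        linarith
      all_goals
        have := hG0 0
        have := hG0 1
        have := hℓ 0
        have := (hw 0).le
        have := hp.le
        first
          | positivity
          | (split_ifs <;> positivity)
    · intro b hb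
      simp only [Finset.mem_insert, Finset.mem_singleton, not_or] at hb
      simp [networkKernel, hb.1, hb.2]
  · obtain ⟨m, rfl⟩ : ∃ m, i = m + 1 := ⟨i - 1, by omega⟩
    have hW0 : W (m + 1) = w m + ℓ (m + 1) + w (m + 1) := by simp [W]
    have hp := hW (m + 1)
    rw [tsum_eq_sum (s := {m, m + 1, m + 2})]
    · rw [Finset.sum_insert (by simp), Finset.sum_pair (by simp)]
      have e1 : networkKernel w ℓ (m + 1) m = ENNReal.ofReal (w m / W (m + 1)) := by
        have hne : m ≠ m + 1 + 1 := by omega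
        rw [hW0]; simp [networkKernel, hne]
      have e2 : networkKernel w ℓ (m + 1) (m + 1) = ENNReal.ofReal (ℓ (m + 1) / W (m + 1)) := by
        rw [hW0]; simp [networkKernel]
      have e3 : networkKernel w ℓ (m + 1) (m + 2) = ENNReal.ofReal (w (m + 1) / W (m + 1)) := by
        rw [hW0]; simp [networkKernel]
      rw [e1, e2, e3]
      rw [← ENNReal.ofReal_mul (div_nonneg (hℓ _) hp.le),
        ← ENNReal.ofReal_mul (div_nonneg (hw _).le hp.le),
        ← ENNReal.ofReal_mul (div_nonneg (hw _).le hp.le),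
        ← ENNReal.ofReal_add, ← ENNReal.ofReal_add, ← ENNReal.ofReal_add]
      · apply ENNReal.ofReal_le_ofReal
        have h0 := hflux m
        have h1 := hflux (m + 1)
        rw [div_mul_eq_mul_div, div_mul_eq_mul_div, div_mul_eq_mul_div, ← add_div, ← add_div,
          ← add_div, div_le_iff₀ hp, hW0]
        have : (if s ≤ m + 1 then (1 : ℝ) else 0)
            = (if s ≤ m then 1 else 0) + if m + 1 = s then 1 else 0 := by
          split_ifs <;> first | omega | norm_num
        rw [this] at h1
        have e : m + 1 + 1 = m + 2 := rfl
        rw [e] at h1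
        linarith
      all_goals
        have := hG0 m
        have := hG0 (m + 1)
        have := hG0 (m + 2)
        have := hℓ (m + 1)
        have := (hw m).le
        have := (hw (m + 1)).le
        have := hp.le
        first
          | positivity
          | (split_ifs <;> positivity)
    · intro b hb
      simp only [Finset.mem_insert, Finset.mem_singleton, not_or] at hb
      simp [networkKernel, hb.1, hb.2.1, hb.2.2]

/-- For the network random walk on `ℕ` with positive edge conductances
`w i = w(i, i+1)` and nonnegative self-loop weights `ℓ i = w(i, i)`: if
`∑_{i ≥ 0} 1 / w i < ∞` then the walk is transient, i.e. for every starting state `j` and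
every state `s`, almost surely the walk visits `s` only finitely often. -/
theorem network_walk_transient
    (w ℓ : ℕ → ℝ) (hw : ∀ i, 0 < w i) (hℓ : ∀ i, 0 ≤ ℓ i)
    (hr : Summable fun i : ℕ => (w i)⁻¹)
    (j : ℕ) (μ : Measure (ℕ → ℕ)) (hμ : IsMarkovChain (networkKernel w ℓ) j μ) (s : ℕ) :
    ∀ᵐ ω ∂μ, {t : ℕ | ω t = s}.Finite := by
  obtain ⟨g, c, C, hc, hC, hgC, hg⟩ := nw_green w ℓ hw hℓ hr s
  have hj := nw_joint _ j μ hμ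
  have hprob : IsProbabilityMeasure μ := hμ.1
  let a : ℕ → ℕ → ENNReal := fun t i => μ {ω | ω t = i}
  have hms : ∀ t i, MeasurableSet {ω : ℕ → ℕ | ω t = i} := fun t i =>
    measurableSet_eq_fun (measurable_pi_apply t) measurable_const
  have key : ∀ (t : ℕ) (A : Set (ℕ → ℕ)), MeasurableSet A →
      ∑' i, μ ({ω | ω t = i} ∩ A) = μ A := by
    intro t A hA
    rw [← measure_iUnion]
    · congr 1
      ext ω
      simp
    · intro i i' hii
      refine Set.disjoint_left.2 fun ω h1 h2 => hii ?_
      exact h1.1.symm.trans h2.1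
    · exact fun i => (hms t i).inter hA
  have hstep : ∀ t k, a (t + 1) k = ∑' i, a t i * networkKernel w ℓ i k := by
    intro t k
    simp only [a]
    rw [← key t _ (hms (t + 1) k)]
    exact tsum_congr fun i => hj t i k
  have hone : ∀ t, ∑' i, a t i = 1 := by
    intro t
    have := key t Set.univ MeasurableSet.univ
    simpa using this
  let E : ℕ → ENNReal := fun t => ∑' i, a t i * g i
  have hE : ∀ t, E (t + 1) + a t s * c ≤ E t := by
    intro t
    have h1 : E (t + 1) = ∑' i, a t i * ∑' k, networkKernel w ℓ i k * g k := by
      simp only [E, hstep, ← ENNReal.tsum_mul_right, ← ENNReal.tsum_mul_left]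
      rw [ENNReal.tsum_comm]
      simp only [mul_assoc]
    have h2 : a t s * c = ∑' i, a t i * (if i = s then c else 0) := by
      rw [tsum_eq_single s]
      · simp
      · intro b hb; simp [hb]
    rw [h1, h2, ← ENNReal.tsum_add]
    refine ENNReal.tsum_le_tsum fun i => ?_
    rw [← mul_add]
    gcongr
    exact hg i
  have hsum : ∀ n, E n + ∑ t ∈ Finset.range n, a t s * c ≤ E 0 := by
    intro n
    induction n with
    | zero => simp
    | succ n ih =>
      rw [Finset.sum_range_succ]
      calc _ = (E (n + 1) + a n s * c) + ∑ t ∈ Finset.range n, a t s * c := by ring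
        _ ≤ E n + ∑ t ∈ Finset.range n, a t s * c := by gcongr; exact hE n
        _ ≤ _ := ih
  have hE0 : E 0 ≤ C := by
    calc E 0 ≤ ∑' i, a 0 i * C := ENNReal.tsum_le_tsum fun i => by gcongr; exact hgC i
      _ = C := by rw [ENNReal.tsum_mul_right, hone, one_mul]
  have hfin : (∑' t, a t s) * c ≤ C := by
    rw [← ENNReal.tsum_mul_right, ENNReal.tsum_eq_iSup_nat]
    exact iSup_le fun n => le_add_self.trans ((hsum n).trans hE0)
  have hne : ∑' t, a t s ≠ ⊤ := by
    intro h
    rw [h, ENNReal.top_mul hc] at hfin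
    exact hC (top_le_iff.1 hfin)
  exact ae_finite_setOfPred_mem hne
end
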